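/- arXiv:1312.2476 — 2 statements merged into one kernel-verified Lean document; each statement's English description precedes it below -/
import Mathlib

section
/- For all x, ξ ∈ ℚ_p⁴ \ {0} with ‖ξ‖_p < p^{−1}‖x‖_p one has |f(x + ξ)|_p = |f(x)|_p. -/
open MeasureTheory Real Filter Set

noncomputable section

namespace PadicParabolic

variable (p : ℕ) [Fact p.Prime]

instance : MeasurableSpace ℚ_[p] := borel _
instance : BorelSpace ℚ_[p] := ⟨rfl⟩

/-- The four dimensional vector space over `ℚ_[p]`, with the max-norm
`‖x‖ = max_{1 ≤ i ≤ 4} |x_i|_p`. -/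
abbrev V (p : ℕ) [Fact p.Prime] := Fin 4 → ℚ_[p]

/-- `a` is a quadratic non-residue modulo `p`. -/
def IsQNR (a : ℤ) : Prop := ∀ b : ZMod p, b ^ 2 ≠ (a : ZMod p)

/-- The elliptic quadratic form `f(x) = x₁² − a x₂² − p x₃² + a p x₄²`. -/
def qf (a : ℤ) (x : V p) : ℚ_[p] :=
  x 0 ^ 2 - (a : ℚ_[p]) * x 1 ^ 2 - (p : ℚ_[p]) * x 2 ^ 2 + (a : ℚ_[p]) * (p : ℚ_[p]) * x 3 ^ 2

/-- The dual elliptic quadratic form `f°(ξ) = a p ξ₁² − p ξ₂² − a ξ₃² + ξ₄²`. -/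
def qfc (a : ℤ) (x : V p) : ℚ_[p] :=
  (a : ℚ_[p]) * (p : ℚ_[p]) * x 0 ^ 2 - (p : ℚ_[p]) * x 1 ^ 2 - (a : ℚ_[p]) * x 2 ^ 2 + x 3 ^ 2

/-- `χ` is the standard additive character `χ(y) = exp(2πi {y}_p)` of `ℚ_p`, characterized as
the unique continuous function with `χ(m/pⁿ) = exp(2πi m/pⁿ)`. -/
def IsStdChar (χ : ℚ_[p] → ℂ) : Prop :=
  Continuous χ ∧ ∀ (m : ℤ) (n : ℕ),
    χ ((m : ℚ_[p]) / (p : ℚ_[p]) ^ n) =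
      Complex.exp (2 * (Real.pi : ℂ) * Complex.I * (m : ℂ) / (p : ℂ) ^ n)

theorem norm_sub_le_max {E : Type*} [SeminormedAddGroup E] [IsUltrametricDist E] (y z : E) :
    ‖y - z‖ ≤ max ‖y‖ ‖z‖ := by
  simpa [sub_eq_add_neg] using IsUltrametricDist.norm_add_le_max y (-z)

theorem norm_sub_eq_max_of_norm_ne_norm {E : Type*} [SeminormedAddGroup E] [IsUltrametricDist E]
    {y z : E} (h : ‖y‖ ≠ ‖z‖) : ‖y - z‖ = max ‖y‖ ‖z‖ := by
  simpa [sub_eq_add_neg] using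
    IsUltrametricDist.norm_add_eq_max_of_norm_ne_norm (x := y) (y := -z) (by rwa [norm_neg])

theorem IsQNR.norm_eq_one {p : ℕ} [Fact p.Prime] {a : ℤ} (ha : IsQNR p a) :
    ‖(a : ℚ_[p])‖ = 1 := by
  refine le_antisymm (Padic.norm_int_le_one a) (not_lt.1 fun h => ?_)
  rw [Padic.norm_intCast_lt_one_iff] at h
  exact ha 0 (by simp [(ZMod.intCast_zmod_eq_zero_iff_dvd a p).2 h])

theorem IsQNR.norm_sq_sub_eq_one {p : ℕ} [Fact p.Prime] {a : ℤ} (ha : IsQNR p a)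
    {t : ℚ_[p]} (ht : ‖t‖ ≤ 1) : ‖t ^ 2 - (a : ℚ_[p])‖ = 1 := by
  obtain ⟨t, rfl⟩ : ∃ s : ℤ_[p], (s : ℚ_[p]) = t := ⟨⟨t, ht⟩, rfl⟩
  suffices ‖t ^ 2 - (a : ℤ_[p])‖ = 1 by simpa [PadicInt.norm_def] using this
  rw [← PadicInt.isUnit_iff]
  by_contra h
  have hm : t ^ 2 - (a : ℤ_[p]) ∈ IsLocalRing.maximalIdeal ℤ_[p] := h
  rw [← PadicInt.ker_toZMod, RingHom.mem_ker, map_sub, map_pow, map_intCast, sub_eq_zero] at hm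
  exact ha _ hm

/-- The norm form of the unramified quadratic extension `ℚ_p(√a)` is anisotropic. -/
theorem IsQNR.norm_sq_sub_mul_sq {p : ℕ} [Fact p.Prime] {a : ℤ} (ha : IsQNR p a)
    (u v : ℚ_[p]) : ‖u ^ 2 - (a : ℚ_[p]) * v ^ 2‖ = max ‖u‖ ‖v‖ ^ 2 := by
  rcases lt_or_ge ‖v‖ ‖u‖ with h | h
  · have h2 : ‖(a : ℚ_[p]) * v ^ 2‖ < ‖u ^ 2‖ := by
      rw [norm_mul, ha.norm_eq_one, one_mul, norm_pow, norm_pow]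
      gcongr
    rw [norm_sub_eq_max_of_norm_ne_norm h2.ne', max_eq_left h2.le, max_eq_left h.le, norm_pow]
  · rw [max_eq_right h]
    rcases eq_or_ne v 0 with rfl | hv
    · have : u = 0 := by simpa using h
      simp [this]
    · have ht : ‖u / v‖ ≤ 1 := by
        rw [norm_div]
        exact div_le_one_of_le₀ h (norm_nonneg v)
      have e : u ^ 2 - (a : ℚ_[p]) * v ^ 2 = ((u / v) ^ 2 - a) * v ^ 2 := by
        field_simp
      rw [e, norm_mul, ha.norm_sq_sub_eq_one ht, one_mul, norm_pow]

theorem norm_le_inv_mul_norm_of_lt {p : ℕ} [Fact p.Prime] {w z : ℚ_[p]} (h : ‖w‖ < ‖z‖) :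
    ‖w‖ ≤ (p : ℝ)⁻¹ * ‖z‖ := by
  have hz : 0 < ‖z‖ := (norm_nonneg w).trans_lt h
  have h1 : ‖w / z‖ < (p : ℝ) ^ (0 : ℤ) := by
    rw [norm_div, zpow_zero]
    exact (div_lt_one hz).2 h
  have h2 := (Padic.norm_le_pow_iff_norm_lt_pow_add_one (w / z) (-1)).2 (by simpa using h1)
  rw [zpow_neg_one, norm_div, div_le_iff₀ hz] at h2
  exact h2

theorem norm_sq_ne_inv_mul_norm_sq {p : ℕ} [Fact p.Prime] {w z : ℚ_[p]} (h : w ≠ 0 ∨ z ≠ 0) :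
    ‖w‖ ^ 2 ≠ (p : ℝ)⁻¹ * ‖z‖ ^ 2 := by
  have hp1 : (1 : ℝ) < p := by exact_mod_cast (Fact.out : p.Prime).one_lt
  have hi0 : (0 : ℝ) < (p : ℝ)⁻¹ := by positivity
  have hi1 : (p : ℝ)⁻¹ < 1 := inv_lt_one_of_one_lt₀ hp1
  rcases lt_or_ge ‖w‖ ‖z‖ with hlt | hge
  · have hz : 0 < ‖z‖ := (norm_nonneg w).trans_lt hlt
    refine ne_of_lt ?_
    calc ‖w‖ ^ 2 ≤ ((p : ℝ)⁻¹ * ‖z‖) ^ 2 := by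
          gcongr
          exact norm_le_inv_mul_norm_of_lt hlt
      _ = (p : ℝ)⁻¹ * ((p : ℝ)⁻¹ * ‖z‖ ^ 2) := by ring
      _ < (p : ℝ)⁻¹ * (1 * ‖z‖ ^ 2) := by gcongr
      _ = (p : ℝ)⁻¹ * ‖z‖ ^ 2 := by ring
  · have hw : 0 < ‖w‖ := by
      rcases h with h | h
      · exact norm_pos_iff.2 h
      · exact (norm_pos_iff.2 h).trans_le hge
    refine ne_of_gt ?_
    calc (p : ℝ)⁻¹ * ‖z‖ ^ 2 ≤ (p : ℝ)⁻¹ * ‖w‖ ^ 2 := by gcongr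
      _ < 1 * ‖w‖ ^ 2 := by gcongr
      _ = ‖w‖ ^ 2 := one_mul _

theorem exists_norm_eq_max {E : Type*} [Norm E] (u v : E) : ∃ w : E, ‖w‖ = max ‖u‖ ‖v‖ := by
  rcases max_choice ‖u‖ ‖v‖ with h | h
  exacts [⟨u, h.symm⟩, ⟨v, h.symm⟩]

theorem IsQNR.norm_qf {p : ℕ} [Fact p.Prime] {a : ℤ} (ha : IsQNR p a) (x : V p) :
    ‖qf p a x‖ = max (max ‖x 0‖ ‖x 1‖ ^ 2) ((p : ℝ)⁻¹ * max ‖x 2‖ ‖x 3‖ ^ 2) := by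
  have e : qf p a x = (x 0 ^ 2 - (a : ℚ_[p]) * x 1 ^ 2) -
      (p : ℚ_[p]) * (x 2 ^ 2 - (a : ℚ_[p]) * x 3 ^ 2) := by
    unfold qf; ring
  have hA := ha.norm_sq_sub_mul_sq (x 0) (x 1)
  have hB : ‖(p : ℚ_[p]) * (x 2 ^ 2 - (a : ℚ_[p]) * x 3 ^ 2)‖ =
      (p : ℝ)⁻¹ * max ‖x 2‖ ‖x 3‖ ^ 2 := by
    rw [norm_mul, Padic.norm_p, ha.norm_sq_sub_mul_sq]
  obtain ⟨w, hw⟩ := exists_norm_eq_max (x 0) (x 1)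
  obtain ⟨z, hz⟩ := exists_norm_eq_max (x 2) (x 3)
  rw [e]
  rw [← hw] at hA ⊢
  rw [← hz] at hB ⊢
  by_cases h : w ≠ 0 ∨ z ≠ 0
  · rw [norm_sub_eq_max_of_norm_ne_norm, hA, hB]
    rw [hA, hB]
    exact norm_sq_ne_inv_mul_norm_sq h
  · push Not at h
    obtain ⟨rfl, rfl⟩ := h
    simp only [norm_zero, ne_eq, OfNat.ofNat_ne_zero, not_false_eq_true, zero_pow, mul_zero,
      norm_eq_zero] at hA hB
    simp [hA, hB]

theorem IsQNR.inv_mul_norm_sq_le_norm_qf {p : ℕ} [Fact p.Prime] {a : ℤ} (ha : IsQNR p a)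
    (x : V p) : (p : ℝ)⁻¹ * ‖x‖ ^ 2 ≤ ‖qf p a x‖ := by
  have hp1 : (1 : ℝ) < p := by exact_mod_cast (Fact.out : p.Prime).one_lt
  have hi1 : (p : ℝ)⁻¹ ≤ 1 := (inv_lt_one_of_one_lt₀ hp1).le
  obtain ⟨i, hi⟩ : ∃ i, ‖x‖ = ‖x i‖ := by
    obtain ⟨i, hi⟩ := Finite.exists_max fun i => ‖x i‖
    exact ⟨i, le_antisymm ((pi_norm_le_iff_of_nonneg (norm_nonneg _)).2 hi) (norm_le_pi_norm x i)⟩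
  have low : ∀ r M : ℝ, 0 ≤ r → r ≤ M → (p : ℝ)⁻¹ * r ^ 2 ≤ M ^ 2 := fun r M hr hM =>
    (mul_le_of_le_one_left (sq_nonneg r) hi1).trans (by gcongr)
  rw [ha.norm_qf, hi]
  fin_cases i
  · exact le_max_of_le_left (low _ _ (norm_nonneg _) (le_max_left _ _))
  · exact le_max_of_le_left (low _ _ (norm_nonneg _) (le_max_right _ _))
  · refine le_max_of_le_right ?_
    gcongr
    exact le_max_left _ _
  · refine le_max_of_le_right ?_
    gcongr
    exact le_max_right _ _

theorem norm_qf_add_sub_qf_le {p : ℕ} [Fact p.Prime] (a : ℤ) {x ξ : V p} (h : ‖ξ‖ ≤ ‖x‖) :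
    ‖qf p a (x + ξ) - qf p a x‖ ≤ ‖ξ‖ * ‖x‖ := by
  have e : qf p a (x + ξ) - qf p a x =
      ξ 0 * (x 0 + x 0 + ξ 0) - (a : ℚ_[p]) * (ξ 1 * (x 1 + x 1 + ξ 1))
        - (p : ℚ_[p]) * (ξ 2 * (x 2 + x 2 + ξ 2))
        + (a : ℚ_[p]) * ((p : ℚ_[p]) * (ξ 3 * (x 3 + x 3 + ξ 3))) := by
    simp only [qf, Pi.add_apply]; ring
  have hc : ∀ i, ‖ξ i * (x i + x i + ξ i)‖ ≤ ‖ξ‖ * ‖x‖ := fun i => by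
    have hx := norm_le_pi_norm x i
    have hξ := norm_le_pi_norm ξ i
    rw [norm_mul]
    gcongr
    exact (IsUltrametricDist.norm_add_le_max _ _).trans
      (max_le ((IsUltrametricDist.norm_add_le_max _ _).trans (max_le hx hx)) (hξ.trans h))
  have hmul : ∀ (n : ℤ) {y : ℚ_[p]} {r : ℝ}, ‖y‖ ≤ r → ‖(n : ℚ_[p]) * y‖ ≤ r := fun n y r hy => by
    rw [norm_mul]
    exact (mul_le_of_le_one_left (norm_nonneg y) (Padic.norm_int_le_one n)).trans hy
  have hp : ∀ {y : ℚ_[p]} {r : ℝ}, ‖y‖ ≤ r → ‖(p : ℚ_[p]) * y‖ ≤ r := fun hy => by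
    simpa using hmul (p : ℤ) hy
  rw [e]
  refine (IsUltrametricDist.norm_add_le_max _ _).trans (max_le ?_ (hmul a (hp (hc 3))))
  refine (norm_sub_le_max _ _).trans (max_le ?_ (hp (hc 2)))
  exact (norm_sub_le_max _ _).trans (max_le (hc 0) (hmul a (hc 1)))

/-- for `x, ξ ∈ ℚ_p⁴ \ {0}` with `‖ξ‖_p < p⁻¹ ‖x‖_p`,
`|f(x + ξ)|_p = |f(x)|_p`. -/
theorem statement1
    (hp : p ≠ 2) (a : ℤ) (ha : IsQNR p a)
    (x ξ : V p) (hx : x ≠ 0) (hξ : ξ ≠ 0)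
    (h : ‖ξ‖ < ((p : ℝ))⁻¹ * ‖x‖) :
    ‖qf p a (x + ξ)‖ = ‖qf p a x‖ := by
  have hp1 : (1 : ℝ) < p := by exact_mod_cast (Fact.out : p.Prime).one_lt
  have hx0 : 0 < ‖x‖ := norm_pos_iff.2 hx
  have hle : ‖ξ‖ ≤ ‖x‖ :=
    h.le.trans (mul_le_of_le_one_left hx0.le (inv_lt_one_of_one_lt₀ hp1).le)
  have hlt : ‖qf p a (x + ξ) - qf p a x‖ < ‖qf p a x‖ :=
    calc ‖qf p a (x + ξ) - qf p a x‖ ≤ ‖ξ‖ * ‖x‖ := norm_qf_add_sub_qf_le a hle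
      _ < (p : ℝ)⁻¹ * ‖x‖ * ‖x‖ := by gcongr
      _ = (p : ℝ)⁻¹ * ‖x‖ ^ 2 := by ring
      _ ≤ ‖qf p a x‖ := ha.inv_mul_norm_sq_le_norm_qf x
  rw [← sub_add_cancel (qf p a (x + ξ)) (qf p a x),
    IsUltrametricDist.norm_add_eq_max_of_norm_ne_norm hlt.ne, max_eq_right hlt.le]

end PadicParabolic
end
end

section
/- For every t > 0 the heat kernel satisfies: (i) Z(x + ξ, t) = Z(x, t) whenever x ∈ ℚ_p⁴ \ {0} and ‖ξ‖_p < p^{−1}‖x‖_p; and (ii) Z(x, t) ≥ 0 for all x ∈ ℚ_p⁴ (in particular Z(x,t) is real). -/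
open MeasureTheory Real Filter Set

noncomputable section

namespace PadicParabolic

variable (p : ℕ) [Fact p.Prime]

/-- The heat kernel `Z(x,t) = ∫_{ℚ_p⁴} χ(ξ·x) e^{−κ t |f°(ξ)|_p^α} d⁴ξ`. -/
def heatZ (μ : Measure (V p)) (χ : ℚ_[p] → ℂ) (a : ℤ) (κ α : ℝ) (x : V p) (t : ℝ) : ℂ :=
  ∫ ξ, χ (∑ i, ξ i * x i) * (Real.exp (-(κ * t * ‖qfc p a ξ‖ ^ α)) : ℂ) ∂μ

variable {p}

lemma denseRange_intCast_div_pow :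
    DenseRange fun q : ℤ × ℕ => (q.1 : ℚ_[p]) / (p : ℚ_[p]) ^ q.2 := by
  intro x
  have hp1 : (1 : ℝ) < p := by exact_mod_cast (Fact.out : p.Prime).one_lt
  have hp0 : (p : ℚ_[p]) ≠ 0 := by exact_mod_cast (Fact.out : p.Prime).ne_zero
  obtain ⟨n, hn⟩ := pow_unbounded_of_one_lt ‖x‖ hp1
  have hx : ‖x * (p : ℚ_[p]) ^ n‖ ≤ 1 := by
    rw [norm_mul, norm_pow, Padic.norm_p, inv_pow, ← div_eq_mul_inv]
    exact (div_le_one (by positivity)).2 hn.le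
  have key (z : ℤ_[p]) : (z : ℚ_[p]) / (p : ℚ_[p]) ^ n ∈
      closure (range fun q : ℤ × ℕ => (q.1 : ℚ_[p]) / (p : ℚ_[p]) ^ q.2) := by
    refine PadicInt.denseRange_intCast.induction_on z ?_ fun m => ?_
    · exact isClosed_closure.preimage (continuous_subtype_val.div_const _)
    · exact subset_closure ⟨(m, n), by simp⟩
  have := key ⟨_, hx⟩
  rwa [mul_div_cancel_right₀ _ (pow_ne_zero _ hp0)] at this

namespace IsStdChar

variable {χ : ℚ_[p] → ℂ}

lemma map_add (hχ : IsStdChar p χ) (x y : ℚ_[p]) : χ (x + y) = χ x * χ y := by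
  have hp0 : (p : ℚ_[p]) ≠ 0 := by exact_mod_cast (Fact.out : p.Prime).ne_zero
  have hp0' : (p : ℂ) ≠ 0 := by exact_mod_cast (Fact.out : p.Prime).ne_zero
  have hc := hχ.1
  refine denseRange_intCast_div_pow.induction_on₂
    (p := fun x y => χ (x + y) = χ x * χ y) (isClosed_eq (by fun_prop) (by fun_prop)) ?_ x y
  rintro ⟨m, k⟩ ⟨n, l⟩
  have h : (m : ℚ_[p]) / (p : ℚ_[p]) ^ k + (n : ℚ_[p]) / (p : ℚ_[p]) ^ l =
      ((m * p ^ l + n * p ^ k : ℤ) : ℚ_[p]) / (p : ℚ_[p]) ^ (k + l) := by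
    push_cast
    field_simp
    ring
  simp only [h, hχ.2, ← Complex.exp_add]
  congr 1
  push_cast
  field_simp
  ring

lemma norm_eq_one (hχ : IsStdChar p χ) (x : ℚ_[p]) : ‖χ x‖ = 1 := by
  refine denseRange_intCast_div_pow.induction_on (p := fun x => ‖χ x‖ = 1) x
    (isClosed_eq hχ.1.norm continuous_const) ?_
  rintro ⟨m, k⟩
  rw [hχ.2, show 2 * (Real.pi : ℂ) * Complex.I * (m : ℂ) / (p : ℂ) ^ k =
    ((2 * Real.pi * m / p ^ k : ℝ) : ℂ) * Complex.I by push_cast; ring]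
  exact Complex.norm_exp_ofReal_mul_I _

lemma map_zero (hχ : IsStdChar p χ) : χ 0 = 1 := by
  simpa using hχ.2 0 0

end IsStdChar

lemma exists_norm_eq_norm_apply (x : V p) : ∃ i, ‖x‖ = ‖x i‖ := by
  obtain ⟨i, -, hi⟩ := Finset.exists_mem_eq_sup _ Finset.univ_nonempty fun i => ‖x i‖₊
  exact ⟨i, by rw [Pi.norm_def, hi, coe_nnnorm]⟩

section QuadraticForm

variable {a : ℤ}

lemma IsQNR.norm_intCast (ha : IsQNR p a) : ‖(a : ℚ_[p])‖ = 1 := by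
  refine le_antisymm (Padic.norm_int_le_one a) (not_lt.1 fun h => ha 0 ?_)
  rw [Padic.norm_intCast_lt_one_iff] at h
  rw [(ZMod.intCast_zmod_eq_zero_iff_dvd a p).2 h]
  simp

lemma IsQNR.norm_sq_sub (ha : IsQNR p a) (u v : ℚ_[p]) :
    ‖u ^ 2 - a * v ^ 2‖ = max ‖u‖ ‖v‖ ^ 2 := by
  have hunit (w : ℚ_[p]) (hw : ‖w‖ = 1) : ‖w ^ 2 - a‖ = 1 := by
    let z : ℤ_[p] := ⟨w, hw.le⟩
    have hz : ((z ^ 2 - (a : ℤ_[p]) : ℤ_[p]) : ℚ_[p]) = w ^ 2 - a := by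
      push_cast
      rfl
    rw [← hz, PadicInt.padic_norm_e_of_padicInt]
    refine le_antisymm (PadicInt.norm_le_one _) (not_lt.1 fun h => ha (PadicInt.toZMod z) ?_)
    have hm : z ^ 2 - (a : ℤ_[p]) ∈ IsLocalRing.maximalIdeal ℤ_[p] := by
      rw [IsLocalRing.mem_maximalIdeal, PadicInt.mem_nonunits]
      exact h
    rw [← PadicInt.ker_toZMod, RingHom.mem_ker] at hm
    simpa [sub_eq_zero] using hm
  have hav : ‖-((a : ℚ_[p]) * v ^ 2)‖ = ‖v‖ ^ 2 := by simp [ha.norm_intCast]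
  by_cases huv : ‖u‖ = ‖v‖
  · rw [huv, max_self]
    by_cases hv : v = 0
    · have hu : u = 0 := by simpa [hv] using huv
      simp [hu, hv]
    · have h := hunit (u / v) (by rw [norm_div, huv, div_self (norm_ne_zero_iff.2 hv)])
      rw [show u ^ 2 - a * v ^ 2 = ((u / v) ^ 2 - a) * v ^ 2 by field_simp, norm_mul, h,
        one_mul, norm_pow]
  · have hne : ‖u ^ 2‖ ≠ ‖-((a : ℚ_[p]) * v ^ 2)‖ := by
      rw [hav, norm_pow]
      exact fun h => huv ((pow_left_inj₀ (norm_nonneg _) (norm_nonneg _) two_ne_zero).1 h)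
    rw [sub_eq_add_neg, Padic.add_eq_max_of_ne hne, hav, norm_pow]
    rcases le_total ‖u‖ ‖v‖ with h | h
    · rw [max_eq_right h, max_eq_right (by gcongr)]
    · rw [max_eq_left h, max_eq_left (by gcongr)]

lemma norm_sq_ne_norm_p_mul_sq {c d : ℚ_[p]} (hc : c ≠ 0) :
    ‖c‖ ^ 2 ≠ ‖(p : ℚ_[p])‖ * ‖d‖ ^ 2 := by
  intro h
  have hp0 : (p : ℚ_[p]) ≠ 0 := by exact_mod_cast (Fact.out : p.Prime).ne_zero
  have hp1 : (1 : ℝ) < p := by exact_mod_cast (Fact.out : p.Prime).one_lt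
  have hd : d ≠ 0 := by
    rintro rfl
    simp [hc] at h
  rw [← norm_pow, ← norm_pow, ← norm_mul,
    Padic.norm_eq_zpow_neg_valuation (pow_ne_zero 2 hc),
    Padic.norm_eq_zpow_neg_valuation (mul_ne_zero hp0 (pow_ne_zero 2 hd)),
    zpow_right_inj₀ (by positivity) hp1.ne', Padic.valuation_mul hp0 (pow_ne_zero 2 hd),
    Padic.valuation_pow, Padic.valuation_pow, Padic.valuation_p] at h
  omega

lemma IsQNR.norm_qfc (ha : IsQNR p a) (x : V p) :
    ‖qfc p a x‖ = max (max ‖x 3‖ ‖x 2‖ ^ 2) ((p : ℝ)⁻¹ * max ‖x 1‖ ‖x 0‖ ^ 2) := by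
  have hB : ‖-((p : ℚ_[p]) * (x 1 ^ 2 - a * x 0 ^ 2))‖ =
      (p : ℝ)⁻¹ * max ‖x 1‖ ‖x 0‖ ^ 2 := by
    rw [norm_neg, norm_mul, ha.norm_sq_sub, Padic.norm_p]
  have hx : qfc p a x =
      (x 3 ^ 2 - a * x 2 ^ 2) + -((p : ℚ_[p]) * (x 1 ^ 2 - a * x 0 ^ 2)) := by
    rw [qfc]; ring
  obtain ⟨c, hc⟩ : ∃ c : ℚ_[p], max ‖x 3‖ ‖x 2‖ = ‖c‖ := by
    rcases max_choice ‖x 3‖ ‖x 2‖ with h | h <;> exact ⟨_, h⟩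
  obtain ⟨d, hd⟩ : ∃ d : ℚ_[p], max ‖x 1‖ ‖x 0‖ = ‖d‖ := by
    rcases max_choice ‖x 1‖ ‖x 0‖ with h | h <;> exact ⟨_, h⟩
  rw [hx]
  by_cases hc0 : c = 0
  · have h0 : x 3 ^ 2 - a * x 2 ^ 2 = 0 := by
      rw [← norm_eq_zero, ha.norm_sq_sub, hc, hc0]; simp
    rw [h0, zero_add, hB, hc, hc0, norm_zero, zero_pow two_ne_zero]
    exact (max_eq_right (by positivity)).symm
  · rw [Padic.add_eq_max_of_ne, hB, ha.norm_sq_sub]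
    rw [hB, ha.norm_sq_sub, hc, hd, ← Padic.norm_p]
    exact norm_sq_ne_norm_p_mul_sq hc0

lemma IsQNR.norm_qfc_le_iff (ha : IsQNR p a) (x : V p) (r : ℝ) :
    ‖qfc p a x‖ ≤ r ↔
      (‖x 3‖ ^ 2 ≤ r ∧ ‖x 2‖ ^ 2 ≤ r) ∧ (p : ℝ)⁻¹ * ‖x 1‖ ^ 2 ≤ r ∧ (p : ℝ)⁻¹ * ‖x 0‖ ^ 2 ≤ r := by
  have hsq (s t : ℝ) (hs : 0 ≤ s) (ht : 0 ≤ t) : max s t ^ 2 = max (s ^ 2) (t ^ 2) := by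
    rcases le_total s t with h | h
    · rw [max_eq_right h, max_eq_right (by gcongr)]
    · rw [max_eq_left h, max_eq_left (by gcongr)]
  rw [ha.norm_qfc, hsq _ _ (norm_nonneg _) (norm_nonneg _),
    hsq _ _ (norm_nonneg _) (norm_nonneg _), mul_max_of_nonneg _ _ (by positivity)]
  simp only [max_le_iff]

lemma IsQNR.norm_qfc_add_le (ha : IsQNR p a) (x y : V p) :
    ‖qfc p a (x + y)‖ ≤ max ‖qfc p a x‖ ‖qfc p a y‖ := by
  have hsq (c d : ℚ_[p]) : ‖c + d‖ ^ 2 ≤ ‖c‖ ^ 2 ∨ ‖c + d‖ ^ 2 ≤ ‖d‖ ^ 2 := by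
    rcases le_max_iff.1 (Padic.nonarchimedean c d) with h | h
    · exact Or.inl (by gcongr)
    · exact Or.inr (by gcongr)
  have hpsq (c d : ℚ_[p]) : (p : ℝ)⁻¹ * ‖c + d‖ ^ 2 ≤ (p : ℝ)⁻¹ * ‖c‖ ^ 2 ∨
      (p : ℝ)⁻¹ * ‖c + d‖ ^ 2 ≤ (p : ℝ)⁻¹ * ‖d‖ ^ 2 :=
    (hsq c d).imp (fun h => by gcongr) (fun h => by gcongr)
  obtain ⟨⟨hx3, hx2⟩, hx1, hx0⟩ := (ha.norm_qfc_le_iff x _).1 (le_max_left _ ‖qfc p a y‖)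
  obtain ⟨⟨hy3, hy2⟩, hy1, hy0⟩ := (ha.norm_qfc_le_iff y _).1 (le_max_right ‖qfc p a x‖ _)
  rw [ha.norm_qfc_le_iff]
  exact ⟨⟨(hsq _ _).elim hx3.trans' hy3.trans', (hsq _ _).elim hx2.trans' hy2.trans'⟩,
    (hpsq _ _).elim hx1.trans' hy1.trans', (hpsq _ _).elim hx0.trans' hy0.trans'⟩

lemma IsQNR.norm_qfc_le_of_norm_le (ha : IsQNR p a) {x y : V p} (h : ‖y‖ ≤ (p : ℝ)⁻¹ * ‖x‖) :
    ‖qfc p a y‖ ≤ ‖qfc p a x‖ := by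
  have hp1 : (p : ℝ)⁻¹ ≤ 1 := inv_le_one_of_one_le₀ (by
    exact_mod_cast (Fact.out : p.Prime).one_le)
  obtain ⟨⟨h3, h2⟩, h1, h0⟩ := (ha.norm_qfc_le_iff x _).1 le_rfl
  have hmul (c : ℚ_[p]) : (p : ℝ)⁻¹ * ‖c‖ ^ 2 ≤ ‖c‖ ^ 2 := mul_le_of_le_one_left (sq_nonneg _) hp1
  have hx : (p : ℝ)⁻¹ * ‖x‖ ^ 2 ≤ ‖qfc p a x‖ := by
    obtain ⟨i, hi⟩ := exists_norm_eq_norm_apply x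
    rw [hi]
    fin_cases i
    exacts [h0, h1, (hmul _).trans h2, (hmul _).trans h3]
  have hy (i : Fin 4) : ‖y i‖ ^ 2 ≤ ‖qfc p a x‖ := calc
    ‖y i‖ ^ 2 ≤ ((p : ℝ)⁻¹ * ‖x‖) ^ 2 := by
      gcongr
      exact (norm_le_pi_norm y i).trans h
    _ = (p : ℝ)⁻¹ * ((p : ℝ)⁻¹ * ‖x‖ ^ 2) := by ring
    _ ≤ (p : ℝ)⁻¹ * ‖x‖ ^ 2 := mul_le_of_le_one_left (by positivity) hp1
    _ ≤ ‖qfc p a x‖ := hx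
  rw [ha.norm_qfc_le_iff]
  exact ⟨⟨hy 3, hy 2⟩, (hmul _).trans (hy 1), (hmul _).trans (hy 0)⟩

end QuadraticForm

/-- Orthogonality of characters: the integral of a character over a subgroup. -/
lemma setIntegral_character {G : Type*} [AddGroup G] [MeasurableSpace G] [MeasurableAdd G]
    (μ : Measure G) [μ.IsAddLeftInvariant] {ψ : G → ℂ} (hψ : ∀ x y, ψ (x + y) = ψ x * ψ y)
    (S : AddSubgroup G) (hS : MeasurableSet (S : Set G)) [Decidable (∀ x ∈ S, ψ x = 1)] :
    ∫ x in S, ψ x ∂μ = if ∀ x ∈ S, ψ x = 1 then (μ.real S : ℂ) else 0 := by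
  split_ifs with h
  · rw [setIntegral_congr_fun hS h]
    simp
  · push Not at h
    obtain ⟨g, hg, hg1⟩ := h
    have htrans : ∫ x in S, ψ x ∂μ = ψ g * ∫ x in S, ψ x ∂μ := by
      rw [← integral_const_mul, ← integral_indicator hS, ← integral_indicator hS,
        ← integral_add_left_eq_self _ g]
      congr 1 with x
      by_cases hx : x ∈ S <;> simp [indicator, S.add_mem_cancel_left hg, hψ, hx]
    have : (ψ g - 1) * ∫ x in S, ψ x ∂μ = 0 := by
      rw [sub_mul, one_mul, ← htrans, sub_self]
    exact (mul_eq_zero.1 this).resolve_left (sub_ne_zero.2 hg1)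

/-- The layer cake decomposition of `exp (-w)` into its superlevel sets, against a bounded `ψ`. -/
lemma integral_mul_exp_neg {G : Type*} [MeasurableSpace G] (μ : Measure G) [SFinite μ]
    {ψ : G → ℂ} {w : G → ℝ} (hψ : Measurable ψ) (hψ1 : ∀ x, ‖ψ x‖ = 1) (hw : Measurable w)
    (hint : Integrable (fun x => Real.exp (-w x)) μ) :
    ∫ x, ψ x * (Real.exp (-w x) : ℂ) ∂μ =
      ∫ u : ℝ, (Real.exp (-u) : ℂ) * ∫ x in {x | w x < u}, ψ x ∂μ := by
  let F : G → ℝ → ℂ := fun x => (Ioi (w x)).indicator fun u => ψ x * (Real.exp (-u) : ℂ)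
  have hF : Measurable (Function.uncurry F) := by
    have : Function.uncurry F = {q : G × ℝ | w q.1 < q.2}.indicator
        fun q => ψ q.1 * (Real.exp (-q.2) : ℂ) := by
      ext ⟨x, u⟩
      simp [F, indicator]
    rw [this]
    exact Measurable.indicator (by fun_prop)
      (measurableSet_lt (by fun_prop) (by fun_prop))
  have hslice (x : G) : Integrable (F x) :=
    (integrable_indicator_iff measurableSet_Ioi).2
      ((integrableOn_exp_neg_Ioi (w x)).ofReal.const_mul (ψ x))
  have hFint : Integrable (Function.uncurry F) (μ.prod volume) := by
    rw [integrable_prod_iff hF.aestronglyMeasurable]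
    refine ⟨.of_forall hslice, hint.congr (.of_forall fun x => ?_)⟩
    have hnorm (u : ℝ) : ‖F x u‖ = (Ioi (w x)).indicator (fun u => Real.exp (-u)) u := by
      simp only [F, norm_indicator_eq_indicator_norm, norm_mul, hψ1, one_mul, Complex.norm_real,
        Real.norm_eq_abs, Real.abs_exp]
    simp only [Function.uncurry_apply_pair, hnorm]
    rw [integral_indicator measurableSet_Ioi, integral_exp_neg_Ioi]
  calc ∫ x, ψ x * (Real.exp (-w x) : ℂ) ∂μ
      = ∫ x, (∫ u, F x u) ∂μ := by
        congr 1 with x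
        rw [integral_indicator measurableSet_Ioi, integral_const_mul, integral_complex_ofReal,
          integral_exp_neg_Ioi]
    _ = ∫ u, ∫ x, F x u ∂μ := integral_integral_swap hFint
    _ = _ := by
        congr 1 with u
        rw [← integral_const_mul, ← integral_indicator (measurableSet_lt hw measurable_const)]
        congr 1 with x
        simp [F, indicator, mul_comm]

section HeatKernel

variable {a : ℤ} {κ α t : ℝ}

lemma levelFunction_le (hκt : 0 ≤ κ * t) (hα : 0 < α) {x y : V p}
    (h : ‖qfc p a x‖ ≤ ‖qfc p a y‖) :
    κ * t * ‖qfc p a x‖ ^ α ≤ κ * t * ‖qfc p a y‖ ^ α := by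
  gcongr

/-- The superlevel set `{ξ | κ t |f°(ξ)|^α < u}` of `ξ ↦ exp (-κ t |f°(ξ)|^α)` as a subgroup. -/
def levelSubgroup (ha : IsQNR p a) (hκt : 0 ≤ κ * t) (hα : 0 < α) {u : ℝ} (hu : 0 < u) :
    AddSubgroup (V p) where
  carrier := {ξ | κ * t * ‖qfc p a ξ‖ ^ α < u}
  zero_mem' := by simpa [qfc, Real.zero_rpow hα.ne'] using hu
  add_mem' {x y} hx hy := by
    rcases le_max_iff.1 (ha.norm_qfc_add_le x y) with h | h
    · exact (levelFunction_le hκt hα h).trans_lt hx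
    · exact (levelFunction_le hκt hα h).trans_lt hy
  neg_mem' {x} hx := by
    have : qfc p a (-x) = qfc p a x := by simp [qfc]
    simpa [this] using hx

lemma mem_levelSubgroup_of_norm_le (ha : IsQNR p a) (hκt : 0 ≤ κ * t) (hα : 0 < α) {u : ℝ}
    (hu : 0 < u) {x y : V p} (hx : x ∈ levelSubgroup ha hκt hα hu)
    (h : ‖y‖ ≤ (p : ℝ)⁻¹ * ‖x‖) : y ∈ levelSubgroup ha hκt hα hu :=
  (levelFunction_le hκt hα (ha.norm_qfc_le_of_norm_le h)).trans_lt hx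

/-- If `S` contains, with each `ξ`, the ball of radius `‖ξ‖ / p`, then the annihilator of `S`
contains, with each `x`, the open ball of radius `‖x‖ / p`. -/
lemma character_eq_one_of_norm_lt {χ : ℚ_[p] → ℂ} {S : Set (V p)}
    (hS : ∀ x ∈ S, ∀ y : V p, ‖y‖ ≤ (p : ℝ)⁻¹ * ‖x‖ → y ∈ S) {x h : V p}
    (hx : ∀ ξ ∈ S, χ (∑ i, ξ i * x i) = 1) (hh : ‖h‖ < (p : ℝ)⁻¹ * ‖x‖) :
    ∀ ξ ∈ S, χ (∑ i, ξ i * h i) = 1 := by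
  intro ξ hξ
  have hp0 : 0 < (p : ℝ)⁻¹ := inv_pos.2 (by exact_mod_cast (Fact.out : p.Prime).pos)
  have hx0 : 0 < ‖x‖ := by
    by_contra! h0
    nlinarith [norm_nonneg h]
  obtain ⟨i, hi⟩ := exists_norm_eq_norm_apply x
  have hxi : x i ≠ 0 := norm_pos_iff.1 (hi ▸ hx0)
  set s := ∑ i, ξ i * h i with hs
  have hsle : ‖s‖ ≤ ‖ξ‖ * ‖h‖ :=
    IsUltrametricDist.norm_sum_le_of_forall_le_of_nonneg (by positivity) fun j _ => by
      rw [norm_mul]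
      gcongr <;> exact norm_le_pi_norm _ j
  have hmem : (Pi.single i (s / x i) : V p) ∈ S := by
    refine hS ξ hξ _ ?_
    rw [Pi.norm_single, norm_div, ← hi, div_le_iff₀ hx0]
    calc ‖s‖ ≤ ‖ξ‖ * ‖h‖ := hsle
      _ ≤ ‖ξ‖ * ((p : ℝ)⁻¹ * ‖x‖) := by gcongr
      _ = (p : ℝ)⁻¹ * ‖ξ‖ * ‖x‖ := by ring
  have := hx _ hmem
  simpa [Pi.single_apply, hxi] using this

lemma IsStdChar.annihilates_add_iff {χ : ℚ_[p] → ℂ} (hχ : IsStdChar p χ) {S : Set (V p)}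
    (hS : ∀ x ∈ S, ∀ y : V p, ‖y‖ ≤ (p : ℝ)⁻¹ * ‖x‖ → y ∈ S) {x h : V p}
    (hh : ‖h‖ < (p : ℝ)⁻¹ * ‖x‖) :
    (∀ ξ ∈ S, χ (∑ i, ξ i * (x + h) i) = 1) ↔ ∀ ξ ∈ S, χ (∑ i, ξ i * x i) = 1 := by
  have hp1 : (p : ℝ)⁻¹ ≤ 1 := inv_le_one_of_one_le₀ (by
    exact_mod_cast (Fact.out : p.Prime).one_le)
  have hlt : ‖h‖ < ‖x‖ := hh.trans_le (mul_le_of_le_one_left (norm_nonneg _) hp1)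
  have hnorm : ‖x + h‖ = ‖x‖ := by
    rw [IsUltrametricDist.norm_add_eq_max_of_norm_ne_norm hlt.ne', max_eq_left hlt.le]
  have hadd (ξ : V p) : χ (∑ i, ξ i * (x + h) i) =
      χ (∑ i, ξ i * x i) * χ (∑ i, ξ i * h i) := by
    rw [← hχ.map_add, ← Finset.sum_add_distrib]
    simp [mul_add]
  refine ⟨fun H ξ hξ => ?_, fun H ξ hξ => ?_⟩
  · have h1 := character_eq_one_of_norm_lt hS H (hnorm.symm ▸ hh) ξ hξ
    rw [← H ξ hξ, hadd, h1, mul_one]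
  · rw [hadd, H ξ hξ, character_eq_one_of_norm_lt hS H hh ξ hξ, mul_one]

lemma measurable_levelFunction (hα : 0 < α) :
    Measurable fun ξ : V p => κ * t * ‖qfc p a ξ‖ ^ α := by
  have hq : Continuous fun ξ : V p => qfc p a ξ := by
    unfold qfc
    fun_prop
  exact ((hq.norm.rpow_const fun _ => Or.inr hα.le).const_mul _).measurable

open Classical in
lemma setIntegral_levelSet (ha : IsQNR p a) (hκt : 0 ≤ κ * t) (hα : 0 < α) {χ : ℚ_[p] → ℂ}
    (hχ : IsStdChar p χ) (μ : Measure (V p)) [μ.IsAddHaarMeasure] {u : ℝ} (hu : 0 < u)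
    (x : V p) :
    ∫ ξ in {ξ | κ * t * ‖qfc p a ξ‖ ^ α < u}, χ (∑ i, ξ i * x i) ∂μ =
      if ∀ ξ ∈ levelSubgroup ha hκt hα hu, χ (∑ i, ξ i * x i) = 1
      then (μ.real (levelSubgroup ha hκt hα hu) : ℂ) else 0 := by
  refine setIntegral_character μ (ψ := fun ξ : V p => χ (∑ i, ξ i * x i)) (fun ξ η => ?_)
    (levelSubgroup ha hκt hα hu) ?_
  · rw [← hχ.map_add, ← Finset.sum_add_distrib]
    simp [add_mul]
  · exact measurableSet_lt (measurable_levelFunction hα) measurable_const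

end HeatKernel

variable (p)

open ComplexOrder in
/-- for every `t > 0`: (i) `Z(x + ξ, t) = Z(x, t)` for `x ≠ 0` and
`‖ξ‖_p < p⁻¹‖x‖_p`; (ii) `Z(x,t) ≥ 0` (in particular `Z(x,t)` is real). -/
theorem statement3
    (hp : p ≠ 2) (a : ℤ) (ha : IsQNR p a)
    (μ : Measure (V p)) [μ.IsAddHaarMeasure] (hμ : μ {x : V p | ‖x‖ ≤ 1} = 1)
    (χ : ℚ_[p] → ℂ) (hχ : IsStdChar p χ)
    (κ α : ℝ) (hκ : 0 < κ) (hα : 0 < α) (t : ℝ) (ht : 0 < t) :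
    (∀ x ξ : V p, x ≠ 0 → ‖ξ‖ < ((p : ℝ))⁻¹ * ‖x‖ →
      heatZ p μ χ a κ α (x + ξ) t = heatZ p μ χ a κ α x t) ∧
    (∀ x : V p, 0 ≤ heatZ p μ χ a κ α x t) := by
  have hκt : 0 ≤ κ * t := by positivity
  have hc := hχ.1
  have hw : Measurable fun ξ : V p => κ * t * ‖qfc p a ξ‖ ^ α := measurable_levelFunction hα
  by_cases hint : Integrable (fun ξ : V p => Real.exp (-(κ * t * ‖qfc p a ξ‖ ^ α))) μ
  · have hZ (x : V p) : heatZ p μ χ a κ α x t = ∫ u : ℝ, (Real.exp (-u) : ℂ) *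
        ∫ ξ in {ξ | κ * t * ‖qfc p a ξ‖ ^ α < u}, χ (∑ i, ξ i * x i) ∂μ :=
      integral_mul_exp_neg μ (ψ := fun ξ : V p => χ (∑ i, ξ i * x i))
        (Continuous.measurable (by fun_prop)) (fun _ => hχ.norm_eq_one _) hw hint
    have hempty {u : ℝ} (hu : u ≤ 0) : {ξ : V p | κ * t * ‖qfc p a ξ‖ ^ α < u} = ∅ :=
      eq_empty_of_forall_notMem fun ξ hξ =>
        (hu.trans (by positivity : 0 ≤ κ * t * ‖qfc p a ξ‖ ^ α)).not_gt hξ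
    refine ⟨fun x h _ hh => ?_, fun x => ?_⟩
    · rw [hZ, hZ]
      congr 1 with u
      congr 1
      rcases le_or_gt u 0 with hu | hu
      · simp [hempty hu]
      · rw [setIntegral_levelSet ha hκt hα hχ μ hu, setIntegral_levelSet ha hκt hα hχ μ hu]
        congr 1
        exact propext (hχ.annihilates_add_iff (S := levelSubgroup ha hκt hα hu)
          (fun _ h₁ _ h₂ => mem_levelSubgroup_of_norm_le ha hκt hα hu h₁ h₂) hh)
    · rw [hZ]
      refine integral_nonneg fun u => mul_nonneg ?_ ?_
      · exact Complex.zero_le_real.2 (Real.exp_pos _).le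
      · rcases le_or_gt u 0 with hu | hu
        · simp [hempty hu]
        · rw [setIntegral_levelSet ha hκt hα hχ μ hu]
          split_ifs
          · exact Complex.zero_le_real.2 measureReal_nonneg
          · exact le_rfl
  · have hZ (x : V p) : heatZ p μ χ a κ α x t = 0 := by
      refine integral_undef fun H => hint (H.norm.congr (.of_forall fun ξ => ?_))
      simp only [norm_mul, hχ.norm_eq_one, one_mul, Complex.norm_real, Real.norm_eq_abs,
        Real.abs_exp]
    simp [hZ]

end PadicParabolic
end
end
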